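/- arXiv:0807.0115 — 2 statements merged into one kernel-verified Lean document; each statement's English description precedes it below -/
import Mathlib

section
/- There exist constants 0 < c₁ ≤ c₂ < ∞, depending only on S and T, with the following property. Let n, k, l ∈ ℕ, let a, b ∈ {1,…,d} with |a−b| = 1, and let x, y ∈ Σ satisfy y ∈ [x_1…x_{n−1}], x_n = a and y_n = b. Set (i,j) := (d,1) if a < b and (i,j) := (1,d) if a > b, and assume that x has an i-block of length k at the n-th level and y has a j-block of length l at the n-th level. Then, writing ξ := π_S(x) and η := π_S(y), one has c₁ ≤ D_Θ(ξ,η) / ( e^{S_nχ(x)} · (e^{kψ(ī)} + e^{lψ(j̄)}) / (e^{kφ(ī)} + e^{lφ(j̄)}) ) ≤ c₂. -/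
open Set Filter Topology

noncomputable section

/-- The unit interval `𝒰 = [0,1]`. -/
abbrev UI : Set ℝ := Set.Icc 0 1

/-- An expanding piecewise `C^{1+ε}` map of the unit interval, presented through its
`d` increasing full inverse branches (ordered left to right, images covering `𝒰` with
pairwise disjoint interiors), each branch being a `C^{1+ε}` diffeomorphism onto its image
whose derivative is `ε`-Hölder continuous with values in `(0,1)`. -/
structure ExpMap (d : ℕ) (ε : ℝ) : Type where
  toFun : ℝ → ℝ
  branch : Fin d → ℝ → ℝ
  branchDeriv : Fin d → ℝ → ℝ
  maps_to : Set.MapsTo toFun UI UI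
  branch_maps_to : ∀ a, Set.MapsTo (branch a) UI UI
  branch_mono : ∀ a, StrictMonoOn (branch a) UI
  right_inv : ∀ a, ∀ ξ ∈ Set.Ico (0 : ℝ) 1, toFun (branch a ξ) = ξ
  map_one : toFun 1 = 1
  branch_hasDeriv : ∀ a, ∀ ξ ∈ UI, HasDerivWithinAt (branch a) (branchDeriv a ξ) UI ξ
  branchDeriv_mem : ∀ a, ∀ ξ ∈ UI, branchDeriv a ξ ∈ Set.Ioo (0 : ℝ) 1
  branchDeriv_holder : ∀ a, ∃ C > 0, ∀ ξ ∈ UI, ∀ η ∈ UI,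
      |branchDeriv a ξ - branchDeriv a η| ≤ C * |ξ - η| ^ ε
  ordered : ∀ a b : Fin d, a < b → ∀ ξ ∈ UI, ∀ η ∈ UI, branch a ξ ≤ branch b η
  cover : UI ⊆ ⋃ a, branch a '' UI

/-- The shift map on `Σ = {1,…,d}^ℕ` (`x n` represents the letter `x_{n+1}`). -/
def shift {d : ℕ} (x : ℕ → Fin d) : ℕ → Fin d := fun n => x (n + 1)

/-- The cylinder set `[x_1 … x_n]`. -/
def cyl {d : ℕ} (x : ℕ → Fin d) (n : ℕ) : Set (ℕ → Fin d) := {y | ∀ m < n, y m = x m}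

/-- Finite approximations `S_{x_1}^{-1} ∘ ⋯ ∘ S_{x_n}^{-1}(0)` to the coding map. -/
def approx {d : ℕ} {ε : ℝ} (S : ExpMap d ε) (x : ℕ → Fin d) (n : ℕ) : ℝ :=
  (List.range n).foldr (fun m ξ => S.branch (x m) ξ) 0

/-- The coding map `π_S : Σ → 𝒰`. -/
def proj {d : ℕ} {ε : ℝ} (S : ExpMap d ε) (x : ℕ → Fin d) : ℝ := ⨆ n, approx S x n

/-- The potential `φ(x) = log (S_{x_1}^{-1})'(π_S(σ x))` associated with `S`. -/
def pot {d : ℕ} {ε : ℝ} (S : ExpMap d ε) (x : ℕ → Fin d) : ℝ :=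
  Real.log (S.branchDeriv (x 0) (proj S (shift x)))

/-- Birkhoff sums `S_n f(x) = ∑_{m=0}^{n-1} f(σ^m x)`. -/
def birk {d : ℕ} (f : (ℕ → Fin d) → ℝ) (n : ℕ) (x : ℕ → Fin d) : ℝ :=
  ∑ m ∈ Finset.range n, f (shift^[m] x)

/-- The difference quotient `D_Θ(ξ, η) = (Θ(ξ) - Θ(η))/(ξ - η)`. -/
def DQ (Θ : ℝ → ℝ) (ξ η : ℝ) : ℝ := (Θ ξ - Θ η) / (ξ - η)

/-- `Θ` is the conjugacy between `S` and `T` : an increasing homeomorphism of `𝒰`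
with `T ∘ Θ = Θ ∘ S`. -/
def IsConjugacy {d : ℕ} {ε : ℝ} (S T : ExpMap d ε) (Θ : ℝ → ℝ) : Prop :=
  StrictMonoOn Θ UI ∧ ContinuousOn Θ UI ∧ Θ '' UI = UI ∧
    ∀ ξ ∈ UI, T.toFun (Θ ξ) = Θ (S.toFun ξ)

/-- `x` has an `i`-block of length `k` at the `n`-th level:
`x_{n+1} = ⋯ = x_{n+k} = i` and `x_{n+k+1} ≠ i`. -/
def HasBlock {d : ℕ} (x : ℕ → Fin d) (i : Fin d) (k n : ℕ) : Prop :=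
  (∀ m < k, x (n + m) = i) ∧ x (n + k) ≠ i

/-- `x` is eventually constant. -/
def EvConst {d : ℕ} (x : ℕ → Fin d) : Prop := ∃ N : ℕ, ∃ i : Fin d, ∀ n ≥ N, x n = i

/-- `Θ'(ξ)` exists in the generalised sense: `lim_{η→ξ} D_Θ(ξ,η)` exists in `[0,∞]`
(with one-sided limits at the boundary points). -/
def GenDeriv (Θ : ℝ → ℝ) (ξ : ℝ) : Prop :=
  (∃ L : ℝ, Filter.Tendsto (fun η => DQ Θ ξ η) (nhdsWithin ξ (UI \ {ξ})) (nhds L)) ∨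
    Filter.Tendsto (fun η => DQ Θ ξ η) (nhdsWithin ξ (UI \ {ξ})) Filter.atTop

namespace ExpMap

variable {d : ℕ} {ε : ℝ} (S : ExpMap d ε)

lemma branch_continuousOn (a : Fin d) : ContinuousOn (S.branch a) UI :=
  fun ξ hξ => (S.branch_hasDeriv a ξ hξ).continuousWithinAt

lemma branch_le {a : Fin d} {s t : ℝ} (hs : s ∈ UI) (ht : t ∈ UI) (h : s ≤ t) :
    S.branch a s ≤ S.branch a t :=
  (S.branch_mono a).monotoneOn hs ht h

/-- The mean value theorem for an inverse branch. -/
lemma exists_branch_sub_eq (a : Fin d) {s t : ℝ} (hs : s ∈ UI) (ht : t ∈ UI) (h : s ≤ t) :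
    ∃ c ∈ Set.Icc s t, S.branch a t - S.branch a s = S.branchDeriv a c * (t - s) := by
  rcases h.eq_or_lt with rfl | hlt
  · exact ⟨s, by simp, by simp⟩
  have hsub : Set.Icc s t ⊆ UI := Set.Icc_subset_Icc hs.1 ht.2
  obtain ⟨c, hc, hc'⟩ := exists_hasDerivAt_eq_slope (S.branch a) (S.branchDeriv a) hlt
    ((S.branch_continuousOn a).mono hsub) (fun x hx =>
      (S.branch_hasDeriv a x (hsub ⟨hx.1.le, hx.2.le⟩)).hasDerivAt
        (Icc_mem_nhds (hs.1.trans_lt hx.1) (hx.2.trans_le ht.2)))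
  refine ⟨c, ⟨hc.1.le, hc.2.le⟩, ?_⟩
  rw [hc', div_mul_cancel₀ _ (sub_ne_zero.2 hlt.ne')]

lemma branchDeriv_continuousOn (hε : 0 < ε) (a : Fin d) :
    ContinuousOn (S.branchDeriv a) UI := by
  obtain ⟨C, -, hC⟩ := S.branchDeriv_holder a
  intro ξ hξ
  have h0 : Tendsto (fun η : ℝ => C * |η - ξ| ^ ε) (𝓝[UI] ξ) (𝓝 0) := by
    have hc : ContinuousAt (fun η : ℝ => C * |η - ξ| ^ ε) ξ :=
      continuousAt_const.mul ((continuous_abs.comp (continuous_sub_right ξ)).continuousAt.rpow_const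
        (Or.inr hε.le))
    have := hc.tendsto
    simp only [sub_self, abs_zero, Real.zero_rpow hε.ne', mul_zero] at this
    exact this.mono_left nhdsWithin_le_nhds
  refine tendsto_iff_dist_tendsto_zero.2
    (squeeze_zero' (Eventually.of_forall fun _ => dist_nonneg) ?_ h0)
  filter_upwards [self_mem_nhdsWithin] with η hη
  exact hC η hη ξ hξ

lemma exists_branchDeriv_bounds (hε : 0 < ε) :
    ∃ δ : ℝ, 0 < δ ∧ δ < 1 ∧ ∀ a, ∀ ξ ∈ UI, δ ≤ S.branchDeriv a ξ ∧ S.branchDeriv a ξ ≤ 1 - δ := by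
  have key : ∀ a, ∃ δ : ℝ, 0 < δ ∧ ∀ ξ ∈ UI, δ ≤ S.branchDeriv a ξ ∧ S.branchDeriv a ξ ≤ 1 - δ := by
    intro a
    have hne : UI.Nonempty := ⟨0, by simp⟩
    obtain ⟨p, hp, hpmin⟩ := isCompact_Icc.exists_isMinOn hne (S.branchDeriv_continuousOn hε a)
    obtain ⟨q, hq, hqmax⟩ := isCompact_Icc.exists_isMaxOn hne (S.branchDeriv_continuousOn hε a)
    refine ⟨min (S.branchDeriv a p) (1 - S.branchDeriv a q),
      lt_min (S.branchDeriv_mem a p hp).1 (sub_pos.2 (S.branchDeriv_mem a q hq).2),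
      fun ξ hξ => ⟨(min_le_left _ _).trans (hpmin hξ), ?_⟩⟩
    have h1 : S.branchDeriv a ξ ≤ S.branchDeriv a q := hqmax hξ
    have h2 := min_le_right (S.branchDeriv a p) (1 - S.branchDeriv a q)
    linarith
  choose δ hδ hb using key
  rcases isEmpty_or_nonempty (Fin d) with h | h
  · exact ⟨1 / 2, by norm_num, by norm_num, fun a => h.elim a⟩
  · obtain ⟨a₀, ha₀⟩ := Finite.exists_min δ
    refine ⟨δ a₀, hδ a₀, ?_, fun a ξ hξ => ⟨(ha₀ a).trans (hb a ξ hξ).1, ?_⟩⟩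
    · have h0 : (0 : ℝ) ∈ UI := by simp
      have := (hb a₀ 0 h0).1
      have := (S.branchDeriv_mem a₀ 0 h0).2
      linarith
    · linarith [ha₀ a, (hb a ξ hξ).2]

lemma exists_holder_const :
    ∃ C : ℝ, 0 ≤ C ∧ ∀ a, ∀ ξ ∈ UI, ∀ η ∈ UI,
      |S.branchDeriv a ξ - S.branchDeriv a η| ≤ C * |ξ - η| ^ ε := by
  choose C hC hb using S.branchDeriv_holder
  refine ⟨∑ a, C a, Finset.sum_nonneg fun a _ => (hC a).le, fun a ξ hξ η hη => ?_⟩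
  refine (hb a ξ hξ η hη).trans (mul_le_mul_of_nonneg_right ?_ (by positivity))
  exact Finset.single_le_sum (fun a _ => (hC a).le) (Finset.mem_univ a)

/-- The composition `S_{x_1}^{-1} ∘ ⋯ ∘ S_{x_n}^{-1}`. -/
def comp (x : ℕ → Fin d) : ℕ → ℝ → ℝ
  | 0, t => t
  | n + 1, t => S.branch (x 0) (comp (shift x) n t)

@[simp] lemma comp_zero (x : ℕ → Fin d) (t : ℝ) : S.comp x 0 t = t := rfl

lemma comp_succ (x : ℕ → Fin d) (n : ℕ) (t : ℝ) :
    S.comp x (n + 1) t = S.branch (x 0) (S.comp (shift x) n t) := rfl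

lemma comp_mem (x : ℕ → Fin d) (n : ℕ) {t : ℝ} (ht : t ∈ UI) : S.comp x n t ∈ UI := by
  induction n generalizing x with
  | zero => exact ht
  | succ n ih => exact S.branch_maps_to _ (ih (shift x))

lemma comp_le (x : ℕ → Fin d) (n : ℕ) {s t : ℝ} (hs : s ∈ UI) (ht : t ∈ UI) (h : s ≤ t) :
    S.comp x n s ≤ S.comp x n t := by
  induction n generalizing x with
  | zero => exact h
  | succ n ih => exact S.branch_le (S.comp_mem _ n hs) (S.comp_mem _ n ht) (ih (shift x))

lemma comp_congr {x y : ℕ → Fin d} {n : ℕ} (h : ∀ m < n, x m = y m) (t : ℝ) :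
    S.comp x n t = S.comp y n t := by
  induction n generalizing x y with
  | zero => rfl
  | succ n ih =>
    rw [comp_succ, comp_succ, h 0 n.succ_pos,
      ih (x := shift x) (y := shift y) fun m hm => h (m + 1) (by omega)]

lemma approx_succ (x : ℕ → Fin d) (n : ℕ) :
    approx S x (n + 1) = S.branch (x 0) (approx S (shift x) n) := by
  simp only [approx, List.range_succ_eq_map, List.foldr_cons, List.foldr_map]
  rfl

lemma approx_mem_Ico (x : ℕ → Fin d) (n : ℕ) : approx S x n ∈ Set.Ico (0 : ℝ) 1 := by
  induction n generalizing x with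
  | zero => simp [approx]
  | succ n ih =>
    rw [approx_succ]
    obtain ⟨h0, h1⟩ := ih (shift x)
    refine ⟨(S.branch_maps_to _ ⟨h0, h1.le⟩).1, ?_⟩
    exact (S.branch_mono _ ⟨h0, h1.le⟩ ⟨zero_le_one, le_rfl⟩ h1).trans_le
      (S.branch_maps_to (x 0) ⟨zero_le_one, le_rfl⟩).2

lemma approx_mem (x : ℕ → Fin d) (n : ℕ) : approx S x n ∈ UI :=
  Set.Ico_subset_Icc_self (S.approx_mem_Ico x n)

lemma approx_le_succ (x : ℕ → Fin d) (n : ℕ) : approx S x n ≤ approx S x (n + 1) := by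
  induction n generalizing x with
  | zero => exact (S.approx_mem x 1).1
  | succ n ih =>
    rw [S.approx_succ x n, S.approx_succ x (n + 1)]
    exact S.branch_le (S.approx_mem _ _) (S.approx_mem _ _) (ih (shift x))

lemma tendsto_approx (x : ℕ → Fin d) : Tendsto (approx S x) atTop (𝓝 (proj S x)) :=
  tendsto_atTop_ciSup (monotone_nat_of_le_succ (S.approx_le_succ x))
    ⟨1, by rintro _ ⟨n, rfl⟩; exact (S.approx_mem x n).2⟩

lemma proj_mem (x : ℕ → Fin d) : proj S x ∈ UI :=
  isClosed_Icc.mem_of_tendsto (S.tendsto_approx x) (Eventually.of_forall (S.approx_mem x))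

lemma tendsto_approx_within (x : ℕ → Fin d) :
    Tendsto (approx S x) atTop (𝓝[UI] (proj S x)) :=
  tendsto_nhdsWithin_iff.2 ⟨S.tendsto_approx x, Eventually.of_forall (S.approx_mem x)⟩

lemma proj_eq (x : ℕ → Fin d) : proj S x = S.branch (x 0) (proj S (shift x)) := by
  have h1 := (tendsto_add_atTop_iff_nat 1).2 (S.tendsto_approx x)
  simp only [approx_succ] at h1
  exact tendsto_nhds_unique h1
    ((S.branch_continuousOn (x 0) _ (S.proj_mem _)).tendsto.comp (S.tendsto_approx_within _))

lemma proj_eq_comp (x : ℕ → Fin d) (n : ℕ) : proj S x = S.comp x n (proj S (shift^[n] x)) := by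
  induction n generalizing x with
  | zero => rfl
  | succ n ih => rw [proj_eq, comp_succ, ih (shift x), Function.iterate_succ_apply]

lemma exp_pot (x : ℕ → Fin d) :
    Real.exp (pot S x) = S.branchDeriv (x 0) (proj S (shift x)) :=
  Real.exp_log (S.branchDeriv_mem _ _ (S.proj_mem _)).1

lemma branch_first (hd : 0 < d) : S.branch ⟨0, hd⟩ 0 = 0 := by
  have h0 : (0 : ℝ) ∈ UI := by simp
  obtain ⟨a, t, ht, hat⟩ := Set.mem_iUnion.1 (S.cover h0)
  refine le_antisymm ?_ (S.branch_maps_to _ h0).1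
  rcases (Fin.mk_le_of_le_val (Nat.zero_le (a : ℕ)) : (⟨0, hd⟩ : Fin d) ≤ a).eq_or_lt with h | h
  · rw [h]; exact (S.branch_le h0 ht ht.1).trans hat.le
  · exact (S.ordered _ _ h _ h0 _ ht).trans hat.le

lemma branch_last (hd : 0 < d) : S.branch ⟨d - 1, by omega⟩ 1 = 1 := by
  have h1 : (1 : ℝ) ∈ UI := by simp
  obtain ⟨a, t, ht, hat⟩ := Set.mem_iUnion.1 (S.cover h1)
  refine le_antisymm (S.branch_maps_to _ h1).2 ?_
  have hle : a ≤ (⟨d - 1, by omega⟩ : Fin d) := Fin.mk_le_mk.2 (by omega)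
  rcases hle.eq_or_lt with h | h
  · rw [← h]; exact hat.ge.trans (S.branch_le ht h1 ht.2)
  · exact hat.ge.trans (S.ordered _ _ h _ ht _ h1)

lemma branch_adjacent {a b : Fin d} (hab : (a : ℕ) + 1 = b) : S.branch a 1 = S.branch b 0 := by
  have h0 : (0 : ℝ) ∈ UI := by simp
  have h1 : (1 : ℝ) ∈ UI := by simp
  have hlt : a < b := Fin.lt_def.2 (by omega)
  refine (S.ordered a b hlt 1 h1 0 h0).eq_or_lt.resolve_right fun h => ?_
  obtain ⟨q, hq1, hq2⟩ := exists_between h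
  have hq : q ∈ UI := ⟨(S.branch_maps_to a h1).1.trans hq1.le, hq2.le.trans (S.branch_maps_to b h0).2⟩
  obtain ⟨c, t, ht, rfl⟩ := Set.mem_iUnion.1 (S.cover hq)
  rcases le_or_gt c a with hc | hc
  · rcases hc.eq_or_lt with rfl | hc
    · exact hq1.not_ge (S.branch_le ht h1 ht.2)
    · exact hq1.not_ge (S.ordered c a hc _ ht _ h1)
  · have hbc : b ≤ c := Fin.le_def.2 (by have := Fin.lt_def.1 hc; omega)
    rcases hbc.eq_or_lt with rfl | hc
    · exact hq2.not_ge (S.branch_le h0 ht ht.1)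
    · exact hq2.not_ge (S.ordered b c hc _ h0 _ ht)

lemma exists_eq_branch {q : ℝ} (hq : q ∈ Set.Ico (0 : ℝ) 1) :
    ∃ c, ∃ r ∈ Set.Ico (0 : ℝ) 1, S.branch c r = q := by
  obtain ⟨c, t, ht, rfl⟩ := Set.mem_iUnion.1 (S.cover (Set.Ico_subset_Icc_self hq))
  rcases ht.2.eq_or_lt with rfl | h
  · by_cases hc : (c : ℕ) + 1 < d
    · exact ⟨⟨c + 1, hc⟩, 0, by simp, (S.branch_adjacent rfl).symm⟩
    · have hlast : c = ⟨d - 1, by omega⟩ := Fin.ext (by simp; omega)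
      exact absurd (hlast ▸ S.branch_last (by omega)) hq.2.ne
  · exact ⟨c, t, ⟨ht.1, h⟩, rfl⟩

lemma branch_zero_lt {a b : Fin d} (hab : a < b) : S.branch a 0 < S.branch b 0 :=
  (S.branch_mono a (by simp) (by simp) zero_lt_one).trans_le (S.ordered a b hab 1 (by simp) 0 (by simp))

lemma branch_mem_Ico (a : Fin d) {t : ℝ} (ht : t ∈ Set.Ico (0 : ℝ) 1) :
    S.branch a t ∈ Set.Ico (0 : ℝ) 1 :=
  ⟨(S.branch_maps_to a (Set.Ico_subset_Icc_self ht)).1,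
    (S.branch_mono a (Set.Ico_subset_Icc_self ht) (by simp) ht.2).trans_le
      (S.branch_maps_to a (by simp)).2⟩

end ExpMap

namespace IsConjugacy

variable {d : ℕ} {ε : ℝ} {S T : ExpMap d ε} {Θ : ℝ → ℝ}

lemma mem (h : IsConjugacy S T Θ) {t : ℝ} (ht : t ∈ UI) : Θ t ∈ UI :=
  h.2.2.1 ▸ Set.mem_image_of_mem Θ ht

lemma map_zero (h : IsConjugacy S T Θ) : Θ 0 = 0 := by
  have h0 : (0 : ℝ) ∈ UI := by simp
  obtain ⟨t, ht, ht'⟩ := (h.2.2.1.symm ▸ h0 : (0 : ℝ) ∈ Θ '' UI)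
  exact le_antisymm (ht' ▸ h.1.monotoneOn h0 ht ht.1) (h.mem h0).1

lemma mem_Ico (h : IsConjugacy S T Θ) {t : ℝ} (ht : t ∈ Set.Ico (0 : ℝ) 1) :
    Θ t ∈ Set.Ico (0 : ℝ) 1 :=
  ⟨(h.mem (Set.Ico_subset_Icc_self ht)).1,
    (h.1 (Set.Ico_subset_Icc_self ht) (by simp) ht.2).trans_le (h.mem (by simp)).2⟩

/-- The conjugacy maps each image of an inverse branch into the image of some inverse branch. -/
lemma exists_map_branch (h : IsConjugacy S T Θ) (a : Fin d) {t : ℝ} (ht : t ∈ Set.Ico (0 : ℝ) 1) :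
    ∃ c, Θ (S.branch a t) = T.branch c (Θ t) := by
  have hb := S.branch_mem_Ico a ht
  obtain ⟨c, r, hr, hcr⟩ := T.exists_eq_branch (h.mem_Ico hb)
  refine ⟨c, ?_⟩
  have h1 := h.2.2.2 _ (Set.Ico_subset_Icc_self hb)
  rw [S.right_inv a t ht, ← hcr, T.right_inv c r hr] at h1
  rw [← h1, hcr]

lemma map_branch_zero (h : IsConjugacy S T Θ) (a : Fin d) :
    Θ (S.branch a 0) = T.branch a 0 := by
  have h0 : (0 : ℝ) ∈ Set.Ico (0 : ℝ) 1 := by simp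
  choose c hc using fun a => h.exists_map_branch a h0
  simp only [h.map_zero] at hc
  have hmono : StrictMono c := by
    intro a b hab
    by_contra! hle
    have h1 : Θ (S.branch a 0) < Θ (S.branch b 0) :=
      h.1 (S.branch_maps_to a (by simp)) (S.branch_maps_to b (by simp)) (S.branch_zero_lt hab)
    rw [hc, hc] at h1
    rcases hle.eq_or_lt with heq | hlt
    · rw [heq] at h1; exact h1.false
    · exact h1.not_gt (T.branch_zero_lt hlt)
  rw [hc, le_antisymm hmono.apply_le hmono.le_apply]

lemma map_branch (h : IsConjugacy S T Θ) (a : Fin d) {t : ℝ} (ht : t ∈ Set.Ico (0 : ℝ) 1) :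
    Θ (S.branch a t) = T.branch a (Θ t) := by
  have h0 : (0 : ℝ) ∈ UI := by simp
  have h1 : (1 : ℝ) ∈ UI := by simp
  have ht' := Set.Ico_subset_Icc_self ht
  obtain ⟨c, hc⟩ := h.exists_map_branch a ht
  rcases lt_trichotomy a c with hac | rfl | hca
  · have hlt : Θ (S.branch a t) < Θ (S.branch c 0) :=
      h.1 (S.branch_maps_to a ht') (S.branch_maps_to c h0)
        ((S.branch_mono a ht' h1 ht.2).trans_le (S.ordered a c hac 1 h1 0 h0))
    rw [hc, h.map_branch_zero] at hlt
    exact absurd (T.branch_le h0 (h.mem ht') (h.mem ht').1) hlt.not_ge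
  · exact hc
  · have hle : Θ (S.branch a 0) ≤ Θ (S.branch a t) :=
      h.1.monotoneOn (S.branch_maps_to a h0) (S.branch_maps_to a ht') (S.branch_le h0 ht' ht.1)
    rw [hc, h.map_branch_zero] at hle
    have hlt := T.branch_mono c (h.mem ht') h1 (h.mem_Ico ht).2
    exact absurd (hlt.trans_le (T.ordered c a hca 1 h1 0 h0)) hle.not_gt

lemma map_approx (h : IsConjugacy S T Θ) (x : ℕ → Fin d) (n : ℕ) :
    Θ (approx S x n) = approx T x n := by
  induction n generalizing x with
  | zero => exact h.map_zero
  | succ n ih => rw [S.approx_succ, T.approx_succ, h.map_branch _ (S.approx_mem_Ico _ _), ih]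

lemma map_proj (h : IsConjugacy S T Θ) (x : ℕ → Fin d) : Θ (proj S x) = proj T x := by
  have h1 := (h.2.1 _ (S.proj_mem x)).tendsto.comp (S.tendsto_approx_within x)
  exact tendsto_nhds_unique (h1.congr (h.map_approx x)) (T.tendsto_approx x)

end IsConjugacy

lemma birk_succ_eq {d : ℕ} (f : (ℕ → Fin d) → ℝ) (n : ℕ) (x : ℕ → Fin d) :
    birk f (n + 1) x = f x + birk f n (shift x) := by
  simp [birk, Finset.sum_range_succ', add_comm]

lemma birk_const {d : ℕ} (f : (ℕ → Fin d) → ℝ) (n : ℕ) (i : Fin d) :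
    birk f n (fun _ => i) = n * f (fun _ => i) := by
  induction n with
  | zero => simp [birk]
  | succ n ih =>
    rw [birk_succ_eq, show shift (fun _ => i) = (fun _ : ℕ => i) from rfl, ih]
    push_cast; ring

lemma birk_sub {d : ℕ} (f g : (ℕ → Fin d) → ℝ) (n : ℕ) (x : ℕ → Fin d) :
    birk (fun z => f z - g z) n x = birk f n x - birk g n x := by
  simp [birk]

lemma shift_iterate_apply {d : ℕ} (n : ℕ) (x : ℕ → Fin d) (m : ℕ) :
    shift^[n] x m = x (n + m) := by
  induction n generalizing x with
  | zero => simp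
  | succ n ih => rw [Function.iterate_succ_apply, ih, shift]; congr 1; omega

namespace ExpMap

variable {d : ℕ} {ε : ℝ} (S : ExpMap d ε)

lemma comp_sub_le {ρ : ℝ} (hρ : 0 ≤ ρ) (hb : ∀ a, ∀ ξ ∈ UI, S.branchDeriv a ξ ≤ ρ)
    (x : ℕ → Fin d) (n : ℕ) {s t : ℝ} (hs : s ∈ UI) (ht : t ∈ UI) (h : s ≤ t) :
    S.comp x n t - S.comp x n s ≤ ρ ^ n * (t - s) := by
  induction n generalizing x with
  | zero => simp
  | succ n ih =>
    have hs' := S.comp_mem (shift x) n hs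
    have ht' := S.comp_mem (shift x) n ht
    have hle := S.comp_le (shift x) n hs ht h
    obtain ⟨c, hc, hc'⟩ := S.exists_branch_sub_eq (x 0) hs' ht' hle
    rw [comp_succ, comp_succ, hc', pow_succ', mul_assoc]
    exact mul_le_mul (hb _ _ ⟨hs'.1.trans hc.1, hc.2.trans ht'.2⟩) (ih _) (sub_nonneg.2 hle) hρ

lemma abs_comp_sub_le {ρ : ℝ} (hρ : 0 ≤ ρ) (hb : ∀ a, ∀ ξ ∈ UI, S.branchDeriv a ξ ≤ ρ)
    (x : ℕ → Fin d) (n : ℕ) {c r : ℝ} (hr : r ∈ UI)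
    (hc : c ∈ Set.Icc (S.comp x n 0) (S.comp x n 1)) :
    |c - S.comp x n r| ≤ ρ ^ n := by
  have h0 : (0 : ℝ) ∈ UI := by simp
  have h1 : (1 : ℝ) ∈ UI := by simp
  have h := S.comp_sub_le hρ hb x n h0 h1 zero_le_one
  have := S.comp_le x n h0 hr hr.1
  have := S.comp_le x n hr h1 hr.2
  have := hc.1
  have := hc.2
  rw [abs_le]
  constructor <;> linarith

/-- Lengths of cylinder pieces are governed by Birkhoff sums of the potential, up to `exp L`. -/
def HasDistortion (L : ℝ) : Prop :=
  ∀ (n : ℕ) (x : ℕ → Fin d), ∀ s ∈ UI, ∀ t ∈ UI, s ≤ t →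
    Real.exp (-L) * (Real.exp (birk (pot S) n x) * (t - s)) ≤ S.comp x n t - S.comp x n s ∧
      S.comp x n t - S.comp x n s ≤ Real.exp L * (Real.exp (birk (pot S) n x) * (t - s))

/-- The bounded distortion property. -/
lemma exists_hasDistortion (hε : 0 < ε) : ∃ L, S.HasDistortion L := by
  obtain ⟨δ, hδ, hδ1, hb⟩ := S.exists_branchDeriv_bounds hε
  obtain ⟨C, hC, hH⟩ := S.exists_holder_const
  set ρ : ℝ := 1 - δ with hρ
  have hρ0 : 0 < ρ := by linarith
  have hρ1 : ρ < 1 := by linarith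
  set θ : ℝ := ρ ^ ε with hθ
  have hθ0 : 0 ≤ θ := by positivity
  have hθ1 : θ < 1 := Real.rpow_lt_one hρ0.le hρ1 hε
  set A : ℝ := C / δ with hA
  have hA0 : 0 ≤ A := by positivity
  have near : ∀ (a : Fin d) (n : ℕ), ∀ c ∈ UI, ∀ r ∈ UI, |c - r| ≤ ρ ^ n →
      S.branchDeriv a c ≤ Real.exp (A * θ ^ n) * S.branchDeriv a r := by
    intro a n c hc r hr h
    have h1 := (abs_le.1 (hH a c hc r hr)).2
    have h2 : |c - r| ^ ε ≤ θ ^ n := by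
      refine (Real.rpow_le_rpow (abs_nonneg _) h hε.le).trans_eq ?_
      rw [hθ, ← Real.rpow_natCast, ← Real.rpow_mul hρ0.le, mul_comm, Real.rpow_mul hρ0.le,
        Real.rpow_natCast]
    have h3 : C * |c - r| ^ ε ≤ A * θ ^ n * S.branchDeriv a r := by
      calc C * |c - r| ^ ε ≤ C * θ ^ n := by gcongr
        _ = A * θ ^ n * δ := by rw [hA]; field_simp
        _ ≤ _ := by gcongr; exact (hb a r hr).1
    have h4 := Real.add_one_le_exp (A * θ ^ n)
    nlinarith [(hb a r hr).1]
  have main : ∀ (n : ℕ) (x : ℕ → Fin d), ∀ s ∈ UI, ∀ t ∈ UI, s ≤ t →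
      Real.exp (-∑ j ∈ Finset.range n, A * θ ^ j) * (Real.exp (birk (pot S) n x) * (t - s)) ≤
          S.comp x n t - S.comp x n s ∧
        S.comp x n t - S.comp x n s ≤
          Real.exp (∑ j ∈ Finset.range n, A * θ ^ j) * (Real.exp (birk (pot S) n x) * (t - s)) := by
    intro n
    induction n with
    | zero => intro x s hs t ht h; simp [birk]
    | succ n ih =>
      intro x s hs t ht h
      have hs' := S.comp_mem (shift x) n hs
      have ht' := S.comp_mem (shift x) n ht
      have hle := S.comp_le (shift x) n hs ht h
      obtain ⟨c, hc, hc'⟩ := S.exists_branch_sub_eq (x 0) hs' ht' hle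
      have hcU : c ∈ UI := ⟨hs'.1.trans hc.1, hc.2.trans ht'.2⟩
      obtain ⟨ih1, ih2⟩ := ih (shift x) s hs t ht h
      have hdist : |c - proj S (shift x)| ≤ ρ ^ n := by
        rw [S.proj_eq_comp (shift x) n]
        refine S.abs_comp_sub_le hρ0.le (fun a ξ hξ => (hb a ξ hξ).2) _ n (S.proj_mem _)
          ⟨(S.comp_le _ n (by simp) hs hs.1).trans hc.1,
            hc.2.trans (S.comp_le _ n ht (by simp) ht.2)⟩
      have n1 := near (x 0) n c hcU _ (S.proj_mem _) hdist
      have n2 := near (x 0) n _ (S.proj_mem _) c hcU (by rwa [abs_sub_comm])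
      rw [← S.exp_pot x] at n1 n2
      have n3 : Real.exp (-(A * θ ^ n)) * Real.exp (pot S x) ≤ S.branchDeriv (x 0) c := by
        calc _ ≤ Real.exp (-(A * θ ^ n)) * (Real.exp (A * θ ^ n) * S.branchDeriv (x 0) c) := by gcongr
          _ = _ := by rw [← mul_assoc, ← Real.exp_add]; simp
      have hcpos : 0 ≤ S.branchDeriv (x 0) c := (S.branchDeriv_mem _ c hcU).1.le
      have hts : 0 ≤ t - s := sub_nonneg.2 h
      rw [comp_succ, comp_succ, hc', Finset.sum_range_succ, birk_succ_eq, neg_add,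
        Real.exp_add, Real.exp_add, Real.exp_add]
      constructor
      · calc _ = (Real.exp (-(A * θ ^ n)) * Real.exp (pot S x)) *
              (Real.exp (-∑ j ∈ Finset.range n, A * θ ^ j) *
                (Real.exp (birk (pot S) n (shift x)) * (t - s))) := by ring
          _ ≤ _ := mul_le_mul n3 ih1 (by positivity) hcpos
      · calc _ ≤ (Real.exp (A * θ ^ n) * Real.exp (pot S x)) *
              (Real.exp (∑ j ∈ Finset.range n, A * θ ^ j) *
                (Real.exp (birk (pot S) n (shift x)) * (t - s))) :=
              mul_le_mul n1 ih2 (sub_nonneg.2 hle) (by positivity)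
          _ = _ := by ring
  refine ⟨A / (1 - θ), fun n x s hs t ht h => ?_⟩
  have hsum : ∑ j ∈ Finset.range n, A * θ ^ j ≤ A / (1 - θ) := by
    rw [← Finset.mul_sum, div_eq_mul_inv, ← tsum_geometric_of_lt_one hθ0 hθ1]
    exact mul_le_mul_of_nonneg_left
      ((summable_geometric_of_lt_one hθ0 hθ1).sum_le_tsum _ (fun j _ => by positivity)) hA0
  have hts : 0 ≤ t - s := sub_nonneg.2 h
  obtain ⟨m1, m2⟩ := main n x s hs t ht h
  refine ⟨le_trans ?_ m1, m2.trans ?_⟩ <;> gcongr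

variable {S}

lemma branch_sub_ge {δ : ℝ} (hb : ∀ a, ∀ ξ ∈ UI, δ ≤ S.branchDeriv a ξ) (a : Fin d) {s t : ℝ}
    (hs : s ∈ UI) (ht : t ∈ UI) (h : s ≤ t) : δ * (t - s) ≤ S.branch a t - S.branch a s := by
  obtain ⟨c, hc, hc'⟩ := S.exists_branch_sub_eq a hs ht h
  rw [hc']
  exact mul_le_mul_of_nonneg_right (hb a c ⟨hs.1.trans hc.1, hc.2.trans ht.2⟩) (sub_nonneg.2 h)

lemma branch_sub_le (a : Fin d) {s t : ℝ}
    (hs : s ∈ UI) (ht : t ∈ UI) (h : s ≤ t) : S.branch a t - S.branch a s ≤ t - s := by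
  obtain ⟨c, hc, hc'⟩ := S.exists_branch_sub_eq a hs ht h
  rw [hc']
  exact mul_le_of_le_one_left (sub_nonneg.2 h)
    (S.branchDeriv_mem a c ⟨hs.1.trans hc.1, hc.2.trans ht.2⟩).2.le

lemma comp_const_eq_self {i : Fin d} {t : ℝ} (h : S.branch i t = t) (n : ℕ) :
    S.comp (fun _ => i) n t = t := by
  induction n with
  | zero => rfl
  | succ n ih => rw [comp_succ, show shift (fun _ => i) = (fun _ : ℕ => i) from rfl, ih, h]

lemma proj_eq_of_hasBlock {x : ℕ → Fin d} {i : Fin d} {k n : ℕ} (h : HasBlock x i k n) :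
    proj S (shift^[n] x) = S.comp (fun _ => i) k (proj S (shift^[n + k] x)) := by
  rw [proj_eq_comp S _ k, ← Function.iterate_add_apply, Nat.add_comm k n]
  exact comp_congr S (fun m hm => by rw [shift_iterate_apply]; exact h.1 m hm) _

/-- The distance to `0` of a point starting with a block of first letters. -/
lemma proj_bounds_of_hasBlock_first {L δ : ℝ} (hL : S.HasDistortion L)
    (hb : ∀ a, ∀ ξ ∈ UI, δ ≤ S.branchDeriv a ξ) (hd : 0 < d) {x : ℕ → Fin d} {k n : ℕ}
    (h : HasBlock x ⟨0, hd⟩ k n) :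
    Real.exp (-L) * (δ * Real.exp (k * pot S (fun _ => ⟨0, hd⟩))) ≤ proj S (shift^[n] x) ∧
      proj S (shift^[n] x) ≤ Real.exp L * Real.exp (k * pot S (fun _ => ⟨0, hd⟩)) := by
  have h0 : (0 : ℝ) ∈ UI := by simp
  have h1 : (1 : ℝ) ∈ UI := by simp
  set u := proj S (shift^[n + k] x) with hu
  have huU : u ∈ UI := S.proj_mem _
  have hδu : δ ≤ u := by
    rw [hu, proj_eq]
    have hlt : (⟨0, hd⟩ : Fin d) < shift^[n + k] x 0 := by
      rw [shift_iterate_apply]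
      have := h.2
      rw [Fin.lt_def]
      refine Nat.pos_of_ne_zero fun h' => this (Fin.ext h')
    have h2 := S.ordered _ _ hlt 1 h1 _ (S.proj_mem (shift (shift^[n + k] x)))
    have h3 := branch_sub_ge hb ⟨0, hd⟩ h0 h1 zero_le_one
    rw [S.branch_first hd] at h3
    linarith
  have key := hL k (fun _ => ⟨0, hd⟩) 0 h0 u huU huU.1
  rw [← proj_eq_of_hasBlock h, comp_const_eq_self (S.branch_first hd), birk_const, sub_zero,
    sub_zero] at key
  refine ⟨le_trans ?_ key.1, key.2.trans ?_⟩
  · rw [mul_comm δ]; gcongr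
  · gcongr
    exact mul_le_of_le_one_right (Real.exp_pos _).le huU.2

/-- The distance to `1` of a point starting with a block of last letters. -/
lemma one_sub_proj_bounds_of_hasBlock_last {L δ : ℝ} (hL : S.HasDistortion L)
    (hb : ∀ a, ∀ ξ ∈ UI, δ ≤ S.branchDeriv a ξ) (hd : 0 < d) {x : ℕ → Fin d} {k n : ℕ}
    (h : HasBlock x ⟨d - 1, by omega⟩ k n) :
    Real.exp (-L) * (δ * Real.exp (k * pot S (fun _ => ⟨d - 1, by omega⟩))) ≤
        1 - proj S (shift^[n] x) ∧
      1 - proj S (shift^[n] x) ≤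
        Real.exp L * Real.exp (k * pot S (fun _ => ⟨d - 1, by omega⟩)) := by
  have h0 : (0 : ℝ) ∈ UI := by simp
  have h1 : (1 : ℝ) ∈ UI := by simp
  set u := proj S (shift^[n + k] x) with hu
  have huU : u ∈ UI := S.proj_mem _
  have hδu : δ ≤ 1 - u := by
    rw [hu, proj_eq]
    have hlt : shift^[n + k] x 0 < (⟨d - 1, by omega⟩ : Fin d) := by
      rw [shift_iterate_apply]
      refine lt_of_le_of_ne (Fin.le_def.2 ?_) h.2
      have := (x (n + k + 0)).isLt
      simp only
      omega
    have h2 := S.ordered _ _ hlt _ (S.proj_mem (shift (shift^[n + k] x))) 0 h0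
    have h3 := branch_sub_ge hb ⟨d - 1, by omega⟩ h0 h1 zero_le_one
    rw [S.branch_last hd] at h3
    linarith
  have key := hL k (fun _ => ⟨d - 1, by omega⟩) u huU 1 h1 huU.2
  rw [← proj_eq_of_hasBlock h, comp_const_eq_self (S.branch_last hd), birk_const] at key
  refine ⟨le_trans ?_ key.1, key.2.trans ?_⟩
  · rw [mul_comm δ]; gcongr
  · gcongr
    exact mul_le_of_le_one_right (Real.exp_pos _).le (by linarith [huU.1])

variable (S)

/-- The distance between two points separated by a common endpoint of adjacent cylinders. -/
lemma exists_proj_sub_bounds (hε : 0 < ε) (hd : 0 < d) :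
    ∃ c C : ℝ, 0 < c ∧ 0 < C ∧ ∀ (N k l : ℕ) (x y z : ℕ → Fin d),
      (∀ m < N, x m = z m) → (∀ m < N, y m = z m) → (x N : ℕ) + 1 = y N →
      HasBlock x ⟨d - 1, by omega⟩ k (N + 1) → HasBlock y ⟨0, hd⟩ l (N + 1) →
      c * (Real.exp (birk (pot S) (N + 1) z) *
          (Real.exp (k * pot S (fun _ => ⟨d - 1, by omega⟩)) +
            Real.exp (l * pot S (fun _ => ⟨0, hd⟩)))) ≤ proj S y - proj S x ∧
        proj S y - proj S x ≤ C * (Real.exp (birk (pot S) (N + 1) z) *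
          (Real.exp (k * pot S (fun _ => ⟨d - 1, by omega⟩)) +
            Real.exp (l * pot S (fun _ => ⟨0, hd⟩)))) := by
  obtain ⟨δ, hδ, -, hb⟩ := S.exists_branchDeriv_bounds hε
  obtain ⟨L, hL⟩ := S.exists_hasDistortion hε
  have hb' : ∀ a, ∀ ξ ∈ UI, δ ≤ S.branchDeriv a ξ := fun a ξ hξ => (hb a ξ hξ).1
  refine ⟨Real.exp (-L) * (δ * (Real.exp (-L) * δ)), Real.exp L * (Real.exp L * δ⁻¹),
    by positivity, by positivity, fun N k l x y z hx hy hxy hbx hby => ?_⟩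
  have h0 : (0 : ℝ) ∈ UI := by simp
  have h1 : (1 : ℝ) ∈ UI := by simp
  obtain ⟨u1, u2⟩ := one_sub_proj_bounds_of_hasBlock_last hL hb' hd hbx
  obtain ⟨v1, v2⟩ := proj_bounds_of_hasBlock_first hL hb' hd hby
  set E := Real.exp (k * pot S (fun _ => ⟨d - 1, by omega⟩))
  set F := Real.exp (l * pot S (fun _ => ⟨0, hd⟩))
  have hE : 0 < E := Real.exp_pos _
  have hF : 0 < F := Real.exp_pos _
  have hu := S.proj_mem (shift^[N + 1] x)
  have hv := S.proj_mem (shift^[N + 1] y)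
  have ex : proj S (shift^[N] x) = S.branch (x N) (proj S (shift^[N + 1] x)) := by
    rw [S.proj_eq, shift_iterate_apply, Function.iterate_succ_apply']; rfl
  have ey : proj S (shift^[N] y) = S.branch (y N) (proj S (shift^[N + 1] y)) := by
    rw [S.proj_eq, shift_iterate_apply, Function.iterate_succ_apply']; rfl
  have hadj := S.branch_adjacent hxy
  have gu := branch_sub_ge hb' (x N) hu h1 hu.2
  have gu' := branch_sub_le (S := S) (x N) hu h1 hu.2
  have gv := branch_sub_ge hb' (y N) h0 hv hv.1
  have gv' := branch_sub_le (S := S) (y N) h0 hv hv.1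
  rw [← ex] at gu gu'
  rw [← ey] at gv gv'
  have lo : δ * (Real.exp (-L) * δ) * (E + F) ≤ proj S (shift^[N] y) - proj S (shift^[N] x) := by
    have := mul_le_mul_of_nonneg_left (add_le_add u1 v1) hδ.le
    linarith
  have hi : proj S (shift^[N] y) - proj S (shift^[N] x) ≤ Real.exp L * (E + F) := by linarith
  have hle : proj S (shift^[N] x) ≤ proj S (shift^[N] y) := by
    have : 0 ≤ δ * (Real.exp (-L) * δ) * (E + F) := by positivity
    linarith
  obtain ⟨k1, k2⟩ := hL N z _ (S.proj_mem _) _ (S.proj_mem _) hle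
  rw [← S.comp_congr hy, ← S.comp_congr hx, ← S.proj_eq_comp, ← S.proj_eq_comp] at k1 k2
  have hbirk : Real.exp (birk (pot S) (N + 1) z) =
      Real.exp (birk (pot S) N z) * Real.exp (pot S (shift^[N] z)) := by
    rw [birk, Finset.sum_range_succ, Real.exp_add]; rfl
  have hp1 : Real.exp (pot S (shift^[N] z)) ≤ 1 := by
    rw [exp_pot]; exact (S.branchDeriv_mem _ _ (S.proj_mem _)).2.le
  have hp2 : δ ≤ Real.exp (pot S (shift^[N] z)) := by
    rw [exp_pot]; exact hb' _ _ (S.proj_mem _)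
  rw [hbirk]
  set B := Real.exp (birk (pot S) N z)
  have hB : 0 < B := Real.exp_pos _
  set P := Real.exp (pot S (shift^[N] z))
  constructor
  · refine le_trans ?_ k1
    calc _ = Real.exp (-L) * (B * (δ * (Real.exp (-L) * δ) * (E + F))) * P := by ring
      _ ≤ Real.exp (-L) * (B * (δ * (Real.exp (-L) * δ) * (E + F))) :=
          mul_le_of_le_one_right (by positivity) hp1
      _ ≤ _ := by gcongr
  · refine k2.trans ?_
    calc _ ≤ Real.exp L * (B * (Real.exp L * (E + F))) := by gcongr
      _ = Real.exp L * (B * (Real.exp L * (E + F))) * (δ⁻¹ * δ) := by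
          rw [inv_mul_cancel₀ hδ.ne', mul_one]
      _ ≤ Real.exp L * (B * (Real.exp L * (E + F))) * (δ⁻¹ * P) := by gcongr
      _ = _ := by ring

end ExpMap

lemma div_div_bounds {c C c' C' A B X Y : ℝ} (hc : 0 < c) (hC' : 0 < C')
    (hA : 0 < A) (hB : 0 < B) (hX : c * A ≤ X ∧ X ≤ C * A) (hY : c' * B ≤ Y ∧ Y ≤ C' * B)
    (hc' : 0 < c') : c' / C ≤ Y / X / (B / A) ∧ Y / X / (B / A) ≤ C' / c := by
  have hXpos : 0 < X := (mul_pos hc hA).trans_le hX.1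
  have hYpos : 0 < Y := (mul_pos hc' hB).trans_le hY.1
  have e : Y / X / (B / A) = (Y / B) / (X / A) := by field_simp
  have x1 : c ≤ X / A := (le_div_iff₀ hA).2 hX.1
  have x2 : X / A ≤ C := (div_le_iff₀ hA).2 hX.2
  have y1 : c' ≤ Y / B := (le_div_iff₀ hB).2 hY.1
  have y2 : Y / B ≤ C' := (div_le_iff₀ hB).2 hY.2
  rw [e]
  constructor <;> gcongr

/-- Proposition `geometric`.  There are constants `0 < c₁ ≤ c₂ < ∞`,
depending only on `S` and `T`, such that for all `n, k, l ∈ ℕ`, all adjacent letters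
`a, b` with `y ∈ [x_1…x_{n-1}]`, `x_n = a`, `y_n = b`, and `(i,j) = (d,1)` if `a < b`,
`(i,j) = (1,d)` if `a > b`, if `x` has an `i`-block of length `k` and `y` a `j`-block of
length `l` at the `n`-th level, then
`c₁ ≤ D_Θ(π_S x, π_S y) / (e^{S_nχ(x)}·(e^{kψ(ī)}+e^{lψ(j̄)})/(e^{kφ(ī)}+e^{lφ(j̄)})) ≤ c₂`. -/
theorem statement_0 {d : ℕ} {ε : ℝ} (hd : 2 ≤ d) (hε : 0 < ε)
    (S T : ExpMap d ε) (Θ : ℝ → ℝ) (hΘ : IsConjugacy S T Θ) :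
    ∃ c₁ c₂ : ℝ, 0 < c₁ ∧ c₁ ≤ c₂ ∧
      ∀ (n k l : ℕ) (a b i j : Fin d) (x y : ℕ → Fin d),
        1 ≤ n → 1 ≤ k → 1 ≤ l →
        y ∈ cyl x (n - 1) → x (n - 1) = a → y (n - 1) = b →
        (((a : ℕ) + 1 = (b : ℕ) ∧ i = (⟨d - 1, by omega⟩ : Fin d) ∧ j = (⟨0, by omega⟩ : Fin d)) ∨
          ((b : ℕ) + 1 = (a : ℕ) ∧ i = (⟨0, by omega⟩ : Fin d) ∧ j = (⟨d - 1, by omega⟩ : Fin d))) →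
        HasBlock x i k n → HasBlock y j l n →
        c₁ ≤ DQ Θ (proj S x) (proj S y) /
            (Real.exp (birk (fun z => pot T z - pot S z) n x) *
              ((Real.exp ((k : ℝ) * pot T (fun _ => i)) + Real.exp ((l : ℝ) * pot T (fun _ => j))) /
                (Real.exp ((k : ℝ) * pot S (fun _ => i)) + Real.exp ((l : ℝ) * pot S (fun _ => j))))) ∧
        DQ Θ (proj S x) (proj S y) /
            (Real.exp (birk (fun z => pot T z - pot S z) n x) *
              ((Real.exp ((k : ℝ) * pot T (fun _ => i)) + Real.exp ((l : ℝ) * pot T (fun _ => j))) /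
                (Real.exp ((k : ℝ) * pot S (fun _ => i)) + Real.exp ((l : ℝ) * pot S (fun _ => j))))) ≤ c₂ := by
  have hd0 : 0 < d := by omega
  obtain ⟨c, C, hc, hC, hS⟩ := S.exists_proj_sub_bounds hε hd0
  obtain ⟨c', C', hc', hC', hT⟩ := T.exists_proj_sub_bounds hε hd0
  refine ⟨c' / C, max (c' / C) (C' / c), by positivity, le_max_left _ _, ?_⟩
  intro n k l a b i j x y hn _ _ hy hxa hyb hij hbx hby
  obtain ⟨N, rfl⟩ : ∃ N, n = N + 1 := ⟨n - 1, by omega⟩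
  rw [Nat.add_sub_cancel] at hy hxa hyb
  have hden : ∀ s t s' t' e₁ e₂ : ℝ, Real.exp (e₁ - e₂) * ((s + t) / (s' + t')) =
      Real.exp e₁ * (s + t) / (Real.exp e₂ * (s' + t')) := fun s t s' t' e₁ e₂ => by
    rw [Real.exp_sub, div_mul_div_comm]
  rw [birk_sub, hden, DQ, hΘ.map_proj, hΘ.map_proj]
  rcases hij with ⟨hab, rfl, rfl⟩ | ⟨hab, rfl, rfl⟩
  · rw [← neg_sub (proj T y), ← neg_sub (proj S y), neg_div_neg_eq]
    have hxy : (x N : ℕ) + 1 = y N := by rw [hxa, hyb, hab]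
    have h := div_div_bounds hc hC' (by positivity) (by positivity)
      (hS N k l x y x (fun _ _ => rfl) hy hxy hbx hby)
      (hT N k l x y x (fun _ _ => rfl) hy hxy hbx hby) hc'
    exact ⟨h.1, h.2.trans (le_max_right _ _)⟩
  · have hyx : (y N : ℕ) + 1 = x N := by rw [hxa, hyb, hab]
    have h := div_div_bounds hc hC' (by positivity) (by positivity)
      (hS N l k y x x hy (fun _ _ => rfl) hyx hby hbx)
      (hT N l k y x x hy (fun _ _ => rfl) hyx hby hbx) hc'
    rw [add_comm (Real.exp ((k : ℝ) * pot T _)), add_comm (Real.exp ((k : ℝ) * pot S _))]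
    exact ⟨h.1, h.2.trans (le_max_right _ _)⟩
end
end

section
/- One has α > 0; for all k, l ∈ ℕ, (e^{lψ₁} + e^{kψ_d}) / (e^{lφ₁} + e^{kφ_d}) ≤ 2 e^{αk}; and there exists a constant c > 0, depending only on φ₁, φ_d, ψ₁, ψ_d, such that for every k ∈ ℕ, taking l := ⌈α'k⌉, one has (e^{lψ₁} + e^{kψ_d}) / (e^{lφ₁} + e^{kφ_d}) ≥ c e^{αk}. -/
/-- Lemma `keyInequality`.  Let `φ₁, φ_d, ψ₁, ψ_d < 0` with
`ψ₁/φ₁ < min{ψ_d/φ_d, 1}`, and set `α' := φ_d/φ₁`, `α := (ψ₁-φ₁)·φ_d/φ₁`.  Then `α > 0`;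
for all `k, l ∈ ℕ`, `(e^{lψ₁}+e^{kψ_d})/(e^{lφ₁}+e^{kφ_d}) ≤ 2e^{αk}`; and there is
`c > 0` (depending only on `φ₁, φ_d, ψ₁, ψ_d`) such that for every `k`, with `l := ⌈α'k⌉`,
`(e^{lψ₁}+e^{kψ_d})/(e^{lφ₁}+e^{kφ_d}) ≥ c·e^{αk}`. -/
theorem statement_5 (φ₁ φd ψ₁ ψd : ℝ) (hφ₁ : φ₁ < 0) (hφd : φd < 0)
    (hψ₁ : ψ₁ < 0) (hψd : ψd < 0)
    (h : ψ₁ / φ₁ < min (ψd / φd) 1) :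
    let α' : ℝ := φd / φ₁
    let α : ℝ := (ψ₁ - φ₁) * φd / φ₁
    0 < α ∧
    (∀ k l : ℕ,
      (Real.exp ((l : ℝ) * ψ₁) + Real.exp ((k : ℝ) * ψd)) /
          (Real.exp ((l : ℝ) * φ₁) + Real.exp ((k : ℝ) * φd)) ≤ 2 * Real.exp (α * k)) ∧
    ∃ c : ℝ, 0 < c ∧ ∀ k : ℕ,
      c * Real.exp (α * k) ≤
        (Real.exp ((⌈α' * (k : ℝ)⌉ : ℝ) * ψ₁) + Real.exp ((k : ℝ) * ψd)) /
          (Real.exp ((⌈α' * (k : ℝ)⌉ : ℝ) * φ₁) + Real.exp ((k : ℝ) * φd)) := by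
  intro α' α
  obtain ⟨hd, h1⟩ := lt_min_iff.1 h
  have hα' : 0 < α' := div_pos_of_neg_of_neg hφd hφ₁
  have hα'φ : α' * φ₁ = φd := div_mul_cancel₀ φd hφ₁.ne
  have hψφ : φ₁ < ψ₁ := by rwa [div_lt_one_of_neg hφ₁] at h1
  have hα : α = (ψ₁ - φ₁) * α' := mul_div_assoc _ _ _
  have hψd_lt : ψd < α' * ψ₁ := by
    rw [lt_div_iff_of_neg hφd] at hd
    calc ψd < ψ₁ / φ₁ * φd := hd
      _ = α' * ψ₁ := by simp only [α']; ring
  have hαk : ∀ k : ℝ, α * k + k * φd = α' * k * ψ₁ := by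
    intro k
    rw [hα, ← hα'φ]
    ring
  refine ⟨hα ▸ mul_pos (sub_pos.2 hψφ) hα', fun k l => ?_, Real.exp ψ₁ / 2, by positivity,
    fun k => ?_⟩
  · rw [div_le_iff₀ (by positivity)]
    have hk : (0 : ℝ) ≤ k := k.cast_nonneg
    have hd_le : Real.exp (k * ψd) ≤ Real.exp (α * k) * Real.exp (k * φd) := by
      rw [← Real.exp_add, hαk]
      exact Real.exp_le_exp.2 (by nlinarith)
    have h1_le : Real.exp (l * ψ₁) ≤
        Real.exp (α * k) * (Real.exp (l * φ₁) + Real.exp (k * φd)) := by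
      rw [mul_add, ← Real.exp_add, ← Real.exp_add, hαk]
      rcases le_total (l : ℝ) (α' * k) with hl | hl
      · have : Real.exp (l * ψ₁) ≤ Real.exp (α * k + l * φ₁) :=
          Real.exp_le_exp.2 (by rw [hα]; nlinarith)
        linarith [Real.exp_pos (α' * k * ψ₁)]
      · have : Real.exp (l * ψ₁) ≤ Real.exp (α' * k * ψ₁) :=
          Real.exp_le_exp.2 (mul_le_mul_of_nonpos_right hl hψ₁.le)
        linarith [Real.exp_pos (α * k + l * φ₁)]
    have : 0 < Real.exp (α * k) * Real.exp (l * φ₁) := by positivity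
    linarith
  · rw [le_div_iff₀ (by positivity)]
    have hle := Int.le_ceil (α' * (k : ℝ))
    have hlt := Int.ceil_lt_add_one (α' * (k : ℝ))
    set l : ℝ := (⌈α' * (k : ℝ)⌉ : ℝ)
    have hden : Real.exp (l * φ₁) ≤ Real.exp (k * φd) :=
      Real.exp_le_exp.2 (by rw [← hα'φ]; nlinarith)
    have hnum : Real.exp ψ₁ * Real.exp (α * k) * Real.exp (k * φd) ≤ Real.exp (l * ψ₁) := by
      rw [← Real.exp_add, ← Real.exp_add, add_assoc, hαk]
      exact Real.exp_le_exp.2 (by nlinarith)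
    calc Real.exp ψ₁ / 2 * Real.exp (α * k) * (Real.exp (l * φ₁) + Real.exp (k * φd))
        ≤ Real.exp ψ₁ / 2 * Real.exp (α * k) * (Real.exp (k * φd) + Real.exp (k * φd)) := by
          gcongr
      _ = Real.exp ψ₁ * Real.exp (α * k) * Real.exp (k * φd) := by ring
      _ ≤ Real.exp (l * ψ₁) + Real.exp (k * ψd) := by linarith [Real.exp_pos (k * ψd)]
end
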